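/- Let b ≥ 2 be an integer base. For every n ≥ 2: (a) for every i ∈ I, min_{1 ≤ j ≤ n−1} (K_i(j) + K_{−i−2}(n−j)) = K′_i(n); (b) B(n) = (min_{i∈I} K′_i(n) + 2)/(b−1); and (c) for every n ≥ 3, B(n) ≥ B(n−1) + 1 if b is odd and n ∈ {3, 4}, while B(n) ≥ B(n−1) + 2 otherwise. -/

import Mathlib

namespace Kaprekar

/-- Sum of the digits of `v` in base `b`. -/
def s (b v : ℕ) : ℕ := (Nat.digits b v).sum

/-- `f v = v + s v`. -/
def f (b v : ℕ) : ℕ := v + s b v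

/-- `F u` is the number of generators of `u`. -/
noncomputable def F (b u : ℕ) : ℕ := Set.ncard {v : ℕ | f b v = u}

/-- `K n` is the least `u` with exactly `n` generators. -/
noncomputable def K (b n : ℕ) : ℕ := sInf {u : ℕ | F b u = n}

/-- `B n = ⌊log_b K(n)⌋`. -/
noncomputable def B (b n : ℕ) : ℕ := Nat.log b (K b n)

/-- `Ki i n` is the least `u ≡ i (mod b-1)` with exactly `n` generators. -/
noncomputable def Ki (b : ℕ) (i : ZMod (b - 1)) (n : ℕ) : ℕ :=
  sInf {u : ℕ | F b u = n ∧ (u : ZMod (b - 1)) = i}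

/-- The index set `I`: all residues mod `b-1` if `b` is even, the even residues if `b` is odd. -/
def I (b : ℕ) : Set (ZMod (b - 1)) := {i | Even b ∨ ∃ j : ZMod (b - 1), i = 2 * j}

/-- `K'_i(n) = min { K_i(⌈n/2⌉)+K_{-i-2}(⌊n/2⌋), K_i(⌊n/2⌋)+K_{-i-2}(⌈n/2⌉) }`. -/
noncomputable def K' (b : ℕ) (i : ZMod (b - 1)) (n : ℕ) : ℕ :=
  min (Ki b i ((n + 1) / 2) + Ki b (-i - 2) (n / 2))
      (Ki b i (n / 2) + Ki b (-i - 2) ((n + 1) / 2))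

theorem s_eq (b v : ℕ) (hb : 2 ≤ b) : s b v = v % b + s b (v / b) := by
  unfold s
  rcases Nat.eq_zero_or_pos v with rfl | hv
  · simp
  · rw [Nat.digits_def' (by omega) hv]
    simp

theorem s_of_lt {b v : ℕ} (h : v < b) : s b v = v := by
  unfold s
  rcases Nat.eq_zero_or_pos v with rfl | hv
  · simp
  · rw [Nat.digits_of_lt b v (by omega) h]
    simp

theorem s_mul_pow_add {b : ℕ} (hb : 2 ≤ b) {d : ℕ} (hd : d < b) (k w : ℕ) (hw : w < b ^ k) :
    s b (d * b ^ k + w) = d + s b w := by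
  induction k generalizing w with
  | zero =>
    obtain rfl : w = 0 := by simpa using hw
    simp [s_of_lt hd, s_of_lt (show 0 < b by omega)]
  | succ k ih =>
    have h1 : (d * b ^ (k + 1) + w) % b = w % b := by
      rw [show d * b ^ (k + 1) + w = w + b * (d * b ^ k) by ring, Nat.add_mul_mod_self_left]
    have h2 : (d * b ^ (k + 1) + w) / b = d * b ^ k + w / b := by
      rw [show d * b ^ (k + 1) + w = w + b * (d * b ^ k) by ring,
        Nat.add_mul_div_left _ _ (by omega)]
      ring
    have h3 : w / b < b ^ k := by
      rw [Nat.div_lt_iff_lt_mul (by omega)]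
      rwa [pow_succ] at hw
    rw [s_eq b _ hb, h1, h2, ih _ h3, s_eq b w hb]
    omega

theorem s_add_s_compl {b : ℕ} (hb : 2 ≤ b) (k w w' : ℕ) (h : w + w' + 1 = b ^ k) :
    s b w + s b w' = (b - 1) * k := by
  induction k generalizing w w' with
  | zero =>
    obtain ⟨rfl, rfl⟩ : w = 0 ∧ w' = 0 := by
      rw [pow_zero] at h
      omega
    simp [s]
  | succ k ih =>
    have e1 := Nat.div_add_mod w b
    have e2 := Nat.div_add_mod w' b
    have l1 := Nat.mod_lt w (show 0 < b by omega)
    have l2 := Nat.mod_lt w' (show 0 < b by omega)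
    rw [s_eq b w hb, s_eq b w' hb]
    generalize w / b = q at *
    generalize w' / b = q' at *
    generalize w % b = e at *
    generalize w' % b = e' at *
    have h0 : b * (q + q') + (e + e' + 1) = b * b ^ k := by
      rw [← pow_succ', ← h, ← e1, ← e2]
      ring
    have hdvd : b ∣ e + e' + 1 :=
      (Nat.dvd_add_right (Dvd.intro _ rfl)).1 (h0 ▸ Dvd.intro _ rfl)
    obtain ⟨t, ht⟩ := hdvd
    have ht1 : t = 1 := by
      have : t < 2 := by
        by_contra hc
        have : b * 2 ≤ b * t := Nat.mul_le_mul_left _ (by omega)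
        omega
      have : t ≠ 0 := by
        rintro rfl
        omega
      omega
    subst ht1
    have hq : q + q' + 1 = b ^ k := by
      apply Nat.eq_of_mul_eq_mul_left (show 0 < b by omega)
      rw [← h0, ht]
      ring
    have := ih q q' hq
    rw [mul_add]
    omega

theorem mul_le_pow {b : ℕ} (hb : 2 ≤ b) (k : ℕ) : (b - 1) * k + 1 ≤ b ^ k := by
  obtain ⟨a, rfl⟩ : ∃ a, b = a + 1 := ⟨b - 1, by omega⟩
  simp only [Nat.add_sub_cancel]
  induction k with
  | zero => simp
  | succ k ih =>
    rw [pow_succ]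
    nlinarith [Nat.zero_le (a * (a * k))]

theorem mul_succ_le_pow {b : ℕ} (hb : 2 ≤ b) {k : ℕ} (hk : 2 ≤ k) :
    (b - 1) * (k + 1) ≤ b ^ k + 1 := by
  obtain ⟨a, rfl⟩ : ∃ a, b = a + 1 := ⟨b - 1, by omega⟩
  simp only [Nat.add_sub_cancel]
  induction k, hk using Nat.le_induction with
  | base => nlinarith [sq_nonneg ((a : ℤ) - 1)]
  | succ k hk ih =>
    have : 1 ≤ (a + 1) ^ k := Nat.one_le_pow _ _ (by omega)
    rw [pow_succ]
    nlinarith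

theorem f_mul_pow_add {b : ℕ} (hb : 2 ≤ b) {d : ℕ} (hd : d < b) {k w : ℕ} (hw : w < b ^ k) :
    f b (d * b ^ k + w) = d * (b ^ k + 1) + f b w := by
  unfold f
  rw [s_mul_pow_add hb hd k w hw]
  ring

theorem f_add_f_compl {b : ℕ} (hb : 2 ≤ b) {k w w' : ℕ} (h : w + w' + 1 = b ^ k) :
    f b w + f b w' + 1 = b ^ k + (b - 1) * k := by
  have := s_add_s_compl hb k w w' h
  unfold f
  omega

theorem le_f (b v : ℕ) : v ≤ f b v := Nat.le_add_right _ _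

theorem f_pow {b : ℕ} (hb : 2 ≤ b) (k : ℕ) : f b (b ^ k) = b ^ k + 1 := by
  have := f_mul_pow_add hb (show 1 < b by omega) (k := k) (w := 0) (by positivity)
  simpa [f, s] using this

theorem f_of_lt {b v : ℕ} (h : v < b) : f b v = 2 * v := by
  unfold f
  rw [s_of_lt h, two_mul]

theorem finite_setOf_f_eq (b u : ℕ) : {v | f b v = u}.Finite :=
  (Set.finite_Iic u).subset fun v hv => (le_f b v).trans (le_of_eq hv)

theorem exists_of_F_pos {b u : ℕ} (h : F b u ≠ 0) : ∃ v, f b v = u :=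
  Set.nonempty_of_ncard_ne_zero h

/-- The generators of `c (b ^ k + 1) + r` come from those of `r`, by prepending the digit `c`,
and from the generators of the complementary number, by complementing digits. -/
theorem setOf_f_eq {b : ℕ} (hb : 2 ≤ b) {k c r : ℕ} (hc : 1 ≤ c) (hr : r ≤ b ^ k)
    (hu : c * (b ^ k + 1) + r < b ^ (k + 1)) :
    {v | f b v = c * (b ^ k + 1) + r} =
      (fun w => c * b ^ k + w) '' {w | f b w = r} ∪
      (fun w => c * b ^ k - 1 - w) '' {w | w < b ^ k ∧ f b w + r + 2 = (b - 1) * k} := by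
  have hP : 0 < b ^ k := by positivity
  have hcb : c < b := by
    by_contra hcb
    rw [pow_succ'] at hu
    nlinarith
  obtain ⟨c, rfl⟩ : ∃ c', c = c' + 1 := ⟨c - 1, by omega⟩
  have hexp : (c + 1) * b ^ k = c * b ^ k + b ^ k := by ring
  ext v
  simp only [Set.mem_ofPred_eq, Set.mem_union, Set.mem_image]
  constructor
  · intro hv
    have hvlt : v < b ^ (k + 1) := (le_f b v).trans_lt (hv ▸ hu)
    obtain ⟨d, w, hw, rfl⟩ : ∃ d w, w < b ^ k ∧ v = d * b ^ k + w :=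
      ⟨v / b ^ k, v % b ^ k, Nat.mod_lt _ hP, (Nat.div_add_mod' v (b ^ k)).symm⟩
    have hd : d < b := by
      by_contra hd
      rw [pow_succ'] at hvlt
      nlinarith
    rw [f_mul_pow_add hb hd hw] at hv
    obtain ⟨w', hw'⟩ : ∃ w', w + w' + 1 = b ^ k := ⟨b ^ k - 1 - w, by omega⟩
    have hcompl := f_add_f_compl hb hw'
    have hBern := mul_le_pow hb k
    rcases lt_trichotomy d (c + 1) with hlt | rfl | hgt
    · right
      obtain rfl : d = c := by
        by_contra hne
        have : (d + 2) * (b ^ k + 1) ≤ (c + 1) * (b ^ k + 1) :=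
          Nat.mul_le_mul_right _ (by omega)
        have : (d + 2) * (b ^ k + 1) = d * (b ^ k + 1) + 2 * b ^ k + 2 := by ring
        omega
      have : (d + 1) * (b ^ k + 1) = d * (b ^ k + 1) + b ^ k + 1 := by ring
      exact ⟨w', ⟨by omega, by omega⟩, by omega⟩
    · left
      exact ⟨w, by omega, rfl⟩
    · exfalso
      have : (c + 1 + 1) * (b ^ k + 1) ≤ d * (b ^ k + 1) := Nat.mul_le_mul_right _ (by omega)
      have : (c + 1 + 1) * (b ^ k + 1) = (c + 1) * (b ^ k + 1) + b ^ k + 1 := by ring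
      omega
  · rintro (⟨w, hw, rfl⟩ | ⟨w, ⟨hwlt, hw⟩, rfl⟩)
    · have hwlt : w < b ^ k := by
        refine lt_of_le_of_ne (((le_f b w).trans_eq hw).trans hr) ?_
        rintro rfl
        rw [f_pow hb] at hw
        omega
      rw [f_mul_pow_add hb hcb hwlt, hw]
    · obtain ⟨w', hw'⟩ : ∃ w', w + w' + 1 = b ^ k := ⟨b ^ k - 1 - w, by omega⟩
      have hcompl := f_add_f_compl hb hw'
      rw [show (c + 1) * b ^ k - 1 - w = c * b ^ k + w' by omega,
        f_mul_pow_add hb (by omega) (by omega)]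
      have : (c + 1) * (b ^ k + 1) = c * (b ^ k + 1) + b ^ k + 1 := by ring
      omega

theorem F_eq_add_ncard {b : ℕ} (hb : 2 ≤ b) {k c r : ℕ} (hc : 1 ≤ c) (hr : r ≤ b ^ k)
    (hu : c * (b ^ k + 1) + r < b ^ (k + 1)) :
    F b (c * (b ^ k + 1) + r) =
      F b r + {w | w < b ^ k ∧ f b w + r + 2 = (b - 1) * k}.ncard := by
  have hfin : {w | w < b ^ k ∧ f b w + r + 2 = (b - 1) * k}.Finite :=
    (Set.finite_Iio (b ^ k)).subset fun w hw => hw.1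
  have hcP : b ^ k ≤ c * b ^ k := Nat.le_mul_of_pos_left _ hc
  unfold F
  rw [setOf_f_eq hb hc hr hu, Set.ncard_union_eq ?_ ((finite_setOf_f_eq b r).image _)
    (hfin.image _), Set.ncard_image_of_injective _ (add_right_injective _),
    Set.InjOn.ncard_image]
  · rintro x ⟨hx, -⟩ y ⟨hy, -⟩ hxy
    simp only at hxy
    omega
  · rw [Set.disjoint_left]
    rintro _ ⟨x, -, rfl⟩ ⟨y, ⟨hy, -⟩, hxy⟩
    simp only at hxy
    omega

theorem setOf_compl_eq {b : ℕ} (hb : 2 ≤ b) {k r r' : ℕ} (h : r + r' + 2 = (b - 1) * k) :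
    {w | w < b ^ k ∧ f b w + r + 2 = (b - 1) * k} = {w | f b w = r'} := by
  have := mul_le_pow hb k
  ext w
  have := le_f b w
  simp only [Set.mem_ofPred_eq]
  omega

theorem F_eq_add {b : ℕ} (hb : 2 ≤ b) {k c r r' : ℕ} (hc : 1 ≤ c)
    (h : r + r' + 2 = (b - 1) * k) (hu : c * (b ^ k + 1) + r < b ^ (k + 1)) :
    F b (c * (b ^ k + 1) + r) = F b r + F b r' := by
  have := mul_le_pow hb k
  rw [F_eq_add_ncard hb hc (by omega) hu, setOf_compl_eq hb h]
  rfl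

theorem F_pow {b : ℕ} (hb : 2 ≤ b) (k : ℕ) (hF : F b (b ^ k) ≠ 0) :
    ∃ u < b ^ k, F b u = F b (b ^ k) := by
  have hBern := mul_le_pow hb k
  have hlt : ∀ v, f b v = b ^ k → v < b ^ k := by
    intro v hv
    refine lt_of_le_of_ne ((le_f b v).trans_eq hv) ?_
    rintro rfl
    rw [f_pow hb] at hv
    omega
  obtain ⟨v, hv⟩ := exists_of_F_pos hF
  have hvlt := hlt v hv
  have hk : 1 ≤ (b - 1) * k := by
    have := f_add_f_compl hb (show v + (b ^ k - 1 - v) + 1 = b ^ k by omega)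
    omega
  refine ⟨(b - 1) * k - 1, by omega, ?_⟩
  unfold F
  have hset : {v | f b v = b ^ k} =
      (fun w => b ^ k - 1 - w) '' {v | f b v = (b - 1) * k - 1} := by
    ext v
    simp only [Set.mem_ofPred_eq, Set.mem_image]
    constructor
    · intro hv
      have := hlt v hv
      have := f_add_f_compl hb (show v + (b ^ k - 1 - v) + 1 = b ^ k by omega)
      exact ⟨b ^ k - 1 - v, by omega, by omega⟩
    · rintro ⟨w, hw, rfl⟩
      have := le_f b w
      have := f_add_f_compl hb (show w + (b ^ k - 1 - w) + 1 = b ^ k by omega)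
      omega
  rw [hset, Set.InjOn.ncard_image]
  intro x hx y hy hxy
  simp only [Set.mem_ofPred_eq] at hx hy hxy
  have := le_f b x
  have := le_f b y
  omega

theorem natCast_base {b : ℕ} (hb : 2 ≤ b) : ((b : ℕ) : ZMod (b - 1)) = 1 := by
  have : ((b - 1 + 1 : ℕ) : ZMod (b - 1)) = 1 := by
    rw [Nat.cast_add, ZMod.natCast_self]
    simp
  rwa [Nat.sub_add_cancel (by omega)] at this

theorem natCast_f {b : ℕ} (hb : 2 ≤ b) (v : ℕ) : (f b v : ZMod (b - 1)) = 2 * (s b v : ℕ) := by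
  have h : (v : ZMod (b - 1)) = (s b v : ℕ) := by
    rw [ZMod.natCast_eq_natCast_iff]
    rcases eq_or_lt_of_le hb with rfl | hb'
    · exact Nat.modEq_one
    · refine Nat.modEq_digits_sum (b - 1) b ?_ v
      rw [Nat.mod_eq_sub_mod (by omega), show b - (b - 1) = 1 by omega, Nat.mod_eq_of_lt (by omega)]
  unfold f
  rw [Nat.cast_add, h, two_mul]

theorem mem_I_iff {b : ℕ} (hb : 2 ≤ b) {i : ZMod (b - 1)} : i ∈ I b ↔ ∃ j, i = 2 * j := by
  refine ⟨?_, Or.inr⟩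
  rintro (⟨h, hh⟩ | hj)
  · refine ⟨(h : ZMod (b - 1)) * i, ?_⟩
    have := natCast_base hb
    rw [hh, Nat.cast_add, ← hh] at this
    rw [← mul_assoc, two_mul, this, one_mul]
  · exact hj

theorem neg_sub_two_mem_I {b : ℕ} (hb : 2 ≤ b) {i : ZMod (b - 1)} (hi : i ∈ I b) :
    -i - 2 ∈ I b := by
  rw [mem_I_iff hb] at hi ⊢
  obtain ⟨j, rfl⟩ := hi
  exact ⟨-j - 1, by ring⟩

theorem natCast_mem_I {b u : ℕ} (hb : 2 ≤ b) (h : F b u ≠ 0) : (u : ZMod (b - 1)) ∈ I b := by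
  obtain ⟨v, rfl⟩ := exists_of_F_pos h
  exact (mem_I_iff hb).2 ⟨_, natCast_f hb v⟩

theorem natCast_sub_one_mul {b : ℕ} (k : ℕ) : (((b - 1) * k : ℕ) : ZMod (b - 1)) = 0 := by
  simp [Nat.cast_mul]

theorem exists_lt_of_mem_I {b : ℕ} (hb : 2 ≤ b) {i : ZMod (b - 1)} (hi : i ∈ I b) :
    ∃ x : ℕ, x < b - 1 ∧ (Odd b → 2 * x < b - 1) ∧ ((2 * x : ℕ) : ZMod (b - 1)) = i := by
  obtain ⟨j, rfl⟩ := (mem_I_iff hb).1 hi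
  have : NeZero (b - 1) := ⟨by omega⟩
  have hj : ((j.val : ℕ) : ZMod (b - 1)) = j := ZMod.natCast_zmod_val j
  have hjlt := ZMod.val_lt j
  by_cases hodd : Odd b
  · obtain ⟨h, hh⟩ := hodd
    have hm := Nat.mod_lt j.val (show 0 < h by omega)
    refine ⟨j.val % h, by omega, fun _ => by omega, ?_⟩
    have e : ∀ v, 2 * v = 2 * (v % h) + (b - 1) * (v / h) := by
      intro v
      rw [show b - 1 = 2 * h by omega]
      nlinarith [Nat.mod_add_div v h]
    have := congrArg (Nat.cast (R := ZMod (b - 1))) (e j.val)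
    rw [Nat.cast_add, natCast_sub_one_mul, add_zero] at this
    rw [← this]
    push_cast
    rw [hj]
  · exact ⟨j.val, hjlt, fun h => absurd h hodd, by push_cast; rw [hj]⟩

theorem F_two_mul {b x : ℕ} (hx : x < b) (h : Odd b → 2 * x < b) : F b (2 * x) = 1 := by
  unfold F
  rw [Set.ncard_eq_one]
  refine ⟨x, Set.eq_singleton_iff_unique_mem.2 ⟨f_of_lt hx, fun v hv => ?_⟩⟩
  simp only [Set.mem_ofPred_eq] at hv
  have hle := le_f b v
  rcases lt_or_ge v b with hvb | hvb
  · rw [f_of_lt hvb] at hv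
    omega
  · exfalso
    rcases Nat.even_or_odd b with ⟨h', hh⟩ | hodd
    · have := f_mul_pow_add (b := b) (by omega) (show 1 < b by omega) (k := 1) (w := v - b)
        (by rw [pow_one]; omega)
      rw [f_of_lt (show v - b < b by omega), pow_one, one_mul, one_mul,
        show b + (v - b) = v by omega] at this
      omega
    · have := h hodd
      omega

theorem K_le {b u n : ℕ} (h : F b u = n) : K b n ≤ u := Nat.sInf_le h

theorem Ki_le {b u n : ℕ} {i : ZMod (b - 1)} (h : F b u = n) (hi : (u : ZMod (b - 1)) = i) :
    Ki b i n ≤ u := Nat.sInf_le ⟨h, hi⟩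

/-- Every number of generators occurs in every admissible residue class. -/
def AllAttained (b : ℕ) : Prop :=
  ∀ m, 1 ≤ m → ∀ i ∈ I b, ∃ u : ℕ, F b u = m ∧ (u : ZMod (b - 1)) = i

theorem Ki_spec {b : ℕ} (hex : AllAttained b) {m : ℕ} (hm : 1 ≤ m) {i : ZMod (b - 1)}
    (hi : i ∈ I b) : F b (Ki b i m) = m ∧ (Ki b i m : ZMod (b - 1)) = i :=
  Nat.sInf_mem (s := {u : ℕ | F b u = m ∧ (u : ZMod (b - 1)) = i}) (hex m hm i hi)

theorem F_K {b : ℕ} (hb : 2 ≤ b) (hex : AllAttained b) {m : ℕ} (hm : 1 ≤ m) :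
    F b (K b m) = m := by
  refine Nat.sInf_mem (s := {u : ℕ | F b u = m}) ?_
  obtain ⟨u, hu, -⟩ := hex m hm 0 ((mem_I_iff hb).2 ⟨0, by simp⟩)
  exact ⟨u, hu⟩

theorem F_zero {b : ℕ} (hb : 2 ≤ b) : F b 0 = 1 := by
  have := F_two_mul (show 0 < b by omega) (fun _ => by omega)
  simpa using this

theorem K_pos {b : ℕ} (hb : 2 ≤ b) (hex : AllAttained b) {n : ℕ} (hn : 2 ≤ n) : 0 < K b n := by
  rw [Nat.pos_iff_ne_zero]
  intro h
  have := F_K hb hex (show 1 ≤ n by omega)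
  rw [h, F_zero hb] at this
  omega

theorem pow_B_le_Ki {b : ℕ} (hb : 2 ≤ b) (hex : AllAttained b) {n : ℕ} (hn : 2 ≤ n)
    {i : ZMod (b - 1)} (hi : i ∈ I b) : b ^ B b n ≤ Ki b i n :=
  (Nat.pow_log_le_self b (K_pos hb hex hn).ne').trans
    (K_le (Ki_spec hex (by omega) hi).1)

theorem sub_one_mul_B_le {b : ℕ} (hb : 2 ≤ b) (hex : AllAttained b) {n j l : ℕ}
    (hj : 1 ≤ j) (hl : 1 ≤ l) (hn : j + l = n) {i : ZMod (b - 1)} (hi : i ∈ I b) :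
    (b - 1) * B b n ≤ Ki b i j + Ki b (-i - 2) l + 2 := by
  obtain ⟨h1, h2⟩ := Ki_spec hex hj hi
  obtain ⟨h3, h4⟩ := Ki_spec hex hl (neg_sub_two_mem_I hb hi)
  generalize Ki b i j = r at *
  generalize Ki b (-i - 2) l = r' at *
  obtain ⟨k, hk⟩ : (b - 1) ∣ r + r' + 2 := by
    rw [← ZMod.natCast_eq_zero_iff]
    push_cast
    rw [h2, h4]
    ring
  rw [hk]
  refine Nat.mul_le_mul_left _ ?_
  have hBern := mul_le_pow hb k
  have hu : 1 * (b ^ k + 1) + r < b ^ (k + 1) := by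
    have : 2 * b ^ k ≤ b ^ (k + 1) := by
      rw [pow_succ']
      exact Nat.mul_le_mul_right _ hb
    omega
  have hF := F_eq_add hb le_rfl hk hu
  rw [h1, h3, hn] at hF
  exact Nat.lt_succ_iff.1 (Nat.log_lt_of_lt_pow (K_pos hb hex (by omega)).ne'
    ((K_le hF).trans_lt hu))

theorem exists_add_eq_B {b : ℕ} (hb : 2 ≤ b) (hex : AllAttained b) {n : ℕ} (hn : 2 ≤ n) :
    ∃ r r', F b r ≠ 0 ∧ F b r' ≠ 0 ∧ F b r + F b r' = n ∧ r + r' + 2 = (b - 1) * B b n := by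
  have hK := F_K hb hex (show 1 ≤ n by omega)
  have hmin : ∀ u < K b n, F b u ≠ n := fun u hu h => (K_le h).not_gt hu
  have hlow : b ^ B b n ≤ K b n := Nat.pow_log_le_self b (K_pos hb hex hn).ne'
  have hup : K b n < b ^ (B b n + 1) := Nat.lt_pow_succ_log_self (by omega) _
  generalize K b n = u at *
  generalize B b n = k at *
  rcases eq_or_lt_of_le hlow with rfl | hlow
  · obtain ⟨u, hu, hF⟩ := F_pow hb k (by omega)
    exact absurd (hF.trans hK) (hmin u hu)
  · have hdm := Nat.div_add_mod' u (b ^ k + 1)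
    have hr := Nat.mod_lt u (show 0 < b ^ k + 1 by omega)
    have hc : 1 ≤ u / (b ^ k + 1) := Nat.div_pos hlow (by omega)
    generalize u / (b ^ k + 1) = c at *
    generalize u % (b ^ k + 1) = r at *
    subst hdm
    have hF := F_eq_add_ncard hb hc (by omega) hup
    have hru := hmin r (by nlinarith)
    obtain ⟨w, -, hw⟩ := Set.nonempty_of_ncard_ne_zero
      (s := {w | w < b ^ k ∧ f b w + r + 2 = (b - 1) * k}) (by omega)
    have hF' := F_eq_add hb hc (show r + f b w + 2 = (b - 1) * k by omega) hup
    have hr' := hmin (f b w) (by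
      have := mul_le_pow hb k
      omega)
    exact ⟨r, f b w, by omega, by omega, by omega, by omega⟩

theorem exists_Ki_add_eq_B {b : ℕ} (hb : 2 ≤ b) (hex : AllAttained b) {n : ℕ} (hn : 2 ≤ n) :
    ∃ i ∈ I b, ∃ j l, 1 ≤ j ∧ 1 ≤ l ∧ j + l = n ∧
      Ki b i j + Ki b (-i - 2) l + 2 = (b - 1) * B b n := by
  obtain ⟨r, r', h1, h2, h3, h4⟩ := exists_add_eq_B hb hex hn
  have hi := natCast_mem_I hb h1
  refine ⟨r, hi, F b r, F b r', by omega, by omega, h3, le_antisymm ?_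
    (sub_one_mul_B_le hb hex (by omega) (by omega) h3 hi)⟩
  have hr' : (r' : ZMod (b - 1)) = -(r : ZMod (b - 1)) - 2 := by
    have := congrArg (Nat.cast (R := ZMod (b - 1))) h4
    rw [natCast_sub_one_mul] at this
    push_cast at this
    linear_combination this
  have := Ki_le (b := b) (u := r) rfl rfl
  have := Ki_le (b := b) (u := r') rfl hr'
  omega

theorem one_le_B {b : ℕ} (hb : 2 ≤ b) (hex : AllAttained b) {n : ℕ} (hn : 2 ≤ n) : 1 ≤ B b n := by
  obtain ⟨r, r', -, -, -, h⟩ := exists_add_eq_B hb hex hn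
  rw [Nat.one_le_iff_ne_zero]
  intro h0
  rw [h0] at h
  omega

theorem two_le_B_two {b : ℕ} (hb : 2 ≤ b) (hex : AllAttained b) (he : Even b) : 2 ≤ B b 2 := by
  obtain ⟨r, r', h1, h2, -, h⟩ := exists_add_eq_B hb hex le_rfl
  by_contra hB
  have := one_le_B hb hex (le_refl 2)
  rw [show B b 2 = 1 by omega, mul_one] at h
  obtain ⟨v, hv⟩ := exists_of_F_pos h1
  obtain ⟨v', hv'⟩ := exists_of_F_pos h2
  have l1 := le_f b v
  have l2 := le_f b v'
  rw [f_of_lt (by omega)] at hv hv'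
  obtain ⟨a, ha⟩ := he
  omega

theorem exists_le_half {b : ℕ} (hb : 2 ≤ b) (hex : AllAttained b) {n : ℕ} (hn : 2 ≤ n)
    {i : ZMod (b - 1)} (hi : i ∈ I b) (hB : 2 ≤ B b n) :
    ∃ c r, 1 ≤ c ∧ c ≤ b - 1 ∧ (Odd b → 2 * c ≤ b - 1) ∧ 2 * r + 2 ≤ (b - 1) * B b n ∧
      Ki b i n ≤ c * (b ^ B b n + 1) + r := by
  obtain ⟨r, r', hr, hle, hF, h⟩ : ∃ r r', F b r ≠ 0 ∧ r ≤ r' ∧ F b r + F b r' = n ∧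
      r + r' + 2 = (b - 1) * B b n := by
    obtain ⟨r, r', h1, h2, h3, h4⟩ := exists_add_eq_B hb hex hn
    rcases le_total r r' with hle | hle
    · exact ⟨r, r', h1, hle, h3, h4⟩
    · exact ⟨r', r, h2, hle, by omega, by omega⟩
  have hmem : i - r - 2 ∈ I b := by
    obtain ⟨j, rfl⟩ := (mem_I_iff hb).1 hi
    obtain ⟨l, hl⟩ := (mem_I_iff hb).1 (natCast_mem_I hb hr)
    exact (mem_I_iff hb).2 ⟨j - l - 1, by rw [hl]; ring⟩
  obtain ⟨x, hx, hxo, hxi⟩ := exists_lt_of_mem_I hb hmem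
  have hodd : Odd b → 2 * (x + 1) ≤ b - 1 := by
    rintro hb'
    have := hxo hb'
    obtain ⟨h, hh⟩ := hb'
    omega
  refine ⟨x + 1, r, by omega, by omega, hodd, by omega, Ki_le ?_ ?_⟩
  · rw [F_eq_add hb (by omega) h, hF]
    have hpow := mul_succ_le_pow hb hB
    have : (x + 1) * (b ^ B b n + 1) ≤ (b - 1) * (b ^ B b n + 1) :=
      Nat.mul_le_mul_right _ (by omega)
    have : (b - 1) * (b ^ B b n + 1) + b ^ B b n = b ^ (B b n + 1) + (b - 1) := by
      obtain ⟨a, rfl⟩ : ∃ a, b = a + 1 := ⟨b - 1, by omega⟩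
      simp only [Nat.add_sub_cancel]
      ring
    have : (b - 1) * (B b n + 1) = (b - 1) * B b n + (b - 1) := by ring
    omega
  · push_cast [natCast_base hb] at hxi ⊢
    linear_combination hxi

theorem Ki_le_pow {b : ℕ} (hb : 2 ≤ b) (hex : AllAttained b) {n : ℕ} (hn : 2 ≤ n)
    {i : ZMod (b - 1)} (hi : i ∈ I b) (hB : 2 ≤ B b n) :
    Ki b i n ≤ b ^ (B b n + 1) ∧ (Odd b → 2 * Ki b i n ≤ b ^ (B b n + 1)) := by
  obtain ⟨c, r, -, hc, hodd, hr, hK⟩ := exists_le_half hb hex hn hi hB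
  have hpow := mul_succ_le_pow hb hB
  have e1 : (b - 1) * (b ^ B b n + 1) + b ^ B b n = b ^ (B b n + 1) + (b - 1) := by
    obtain ⟨a, rfl⟩ : ∃ a, b = a + 1 := ⟨b - 1, by omega⟩
    simp only [Nat.add_sub_cancel]
    ring
  have e2 : (b - 1) * (B b n + 1) = (b - 1) * B b n + (b - 1) := by ring
  constructor
  · have := Nat.mul_le_mul_right (b ^ B b n + 1) hc
    omega
  · intro ho
    have := Nat.mul_le_mul_right (b ^ B b n + 1) (hodd ho)
    rw [mul_assoc] at this
    omega

theorem Ki_one_le {b : ℕ} (hb : 2 ≤ b) {i : ZMod (b - 1)} (hi : i ∈ I b) :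
    Ki b i 1 ≤ 2 * b - 4 ∧ (Odd b → Ki b i 1 < b) := by
  obtain ⟨x, hx, hxo, hxi⟩ := exists_lt_of_mem_I hb hi
  have := Ki_le (F_two_mul (show x < b by omega) (fun h => by have := hxo h; omega)) hxi
  exact ⟨by omega, fun h => by have := hxo h; omega⟩

theorem Ki_two_le {b : ℕ} (hb : 2 ≤ b) (ho : Odd b) {i : ZMod (b - 1)} (hi : i ∈ I b) :
    Ki b i 2 ≤ 2 * b - 2 := by
  have hmem : i - 2 ∈ I b := by
    obtain ⟨j, rfl⟩ := (mem_I_iff hb).1 hi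
    exact (mem_I_iff hb).2 ⟨j - 1, by ring⟩
  obtain ⟨x, hx, hxo, hxi⟩ := exists_lt_of_mem_I hb hmem
  have hx2 := hxo ho
  obtain ⟨h, hh⟩ := ho
  obtain ⟨y, hy⟩ : ∃ y, 2 * x + 2 * y + 2 = b - 1 := ⟨h - 1 - x, by omega⟩
  have hF := F_eq_add hb (le_refl 1) (k := 1) (r := 2 * x) (r' := 2 * y) (by omega)
    (by rw [pow_succ b 1, pow_one]; nlinarith [show 2 * x + 3 ≤ b by omega])
  rw [F_two_mul (by omega) (fun _ => by omega), F_two_mul (by omega) (fun _ => by omega)] at hF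
  have hle := Ki_le (n := 2) (i := i) hF (by
    push_cast [natCast_base hb] at hxi ⊢
    rw [pow_one]
    linear_combination hxi)
  rw [pow_one] at hle
  omega

/-- The growth of `B` from `n - 1` to `n`. -/
def Grows (b n : ℕ) : Prop :=
  B b (n - 1) + 1 ≤ B b n ∧ (Even b ∨ 5 ≤ n → B b (n - 1) + 2 ≤ B b n)

theorem B_mono_of_grows {b m n : ℕ} (hm : 2 ≤ m) (hmn : m ≤ n)
    (H : ∀ l, 3 ≤ l → l ≤ n → Grows b l) : B b m ≤ B b n := by
  induction n, hmn using Nat.le_induction with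
  | base => exact le_rfl
  | succ n hmn ih =>
    have h1 := ih fun l h3 hl => H l h3 (by omega)
    have h2 := (H (n + 1) (by omega) le_rfl).1
    simp only [Nat.add_sub_cancel] at h2
    omega

theorem two_le_B_of_grows {b : ℕ} (hb : 2 ≤ b) (hex : AllAttained b) {n : ℕ} (hn : 2 ≤ n)
    (H : ∀ l, 3 ≤ l → l ≤ n → Grows b l) (h : Even b ∨ 3 ≤ n) : 2 ≤ B b n := by
  rcases Nat.even_or_odd b with he | ho
  · exact (two_le_B_two hb hex he).trans (B_mono_of_grows le_rfl hn H)
  · have hn3 : 3 ≤ n := h.resolve_left (Nat.not_even_iff_odd.2 ho)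
    have h1 := one_le_B hb hex (le_refl 2)
    have h2 := (H 3 le_rfl hn3).1
    have h3 := B_mono_of_grows (b := b) (show 2 ≤ 3 by omega) hn3 H
    simp only [Nat.reduceSub] at h2
    omega

theorem two_mul_Ki_le {b : ℕ} (hb : 2 ≤ b) (hex : AllAttained b) {m : ℕ} (hm : 2 ≤ m)
    (H : ∀ l, 3 ≤ l → l ≤ m + 1 → Grows b l) {i : ZMod (b - 1)} (hi : i ∈ I b) :
    2 * Ki b i m ≤ b ^ B b (m + 1) := by
  have hG := H (m + 1) (by omega) le_rfl
  simp only [Grows, Nat.add_sub_cancel] at hG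
  rcases Nat.even_or_odd b with he | ho
  · have hB := two_le_B_of_grows hb hex hm (fun l h3 hl => H l h3 (by omega)) (Or.inl he)
    calc 2 * Ki b i m ≤ b * b ^ (B b m + 1) := Nat.mul_le_mul hb (Ki_le_pow hb hex hm hi hB).1
      _ = b ^ (B b m + 2) := by ring
      _ ≤ b ^ B b (m + 1) := Nat.pow_le_pow_right (by omega) (hG.2 (Or.inl he))
  · rcases eq_or_lt_of_le hm with rfl | hm3
    · have hB := two_le_B_of_grows hb hex (by omega) H (Or.inr le_rfl)
      have h1 : b ^ 2 ≤ b ^ B b (2 + 1) := Nat.pow_le_pow_right (by omega) hB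
      have h2 := Ki_two_le hb ho hi
      obtain ⟨a, rfl⟩ : ∃ a, b = a + 2 := ⟨b - 2, by omega⟩
      have h3 : Ki (a + 2) i 2 ≤ 2 * a + 2 := by omega
      nlinarith
    · have hB := two_le_B_of_grows hb hex hm (fun l h3 hl => H l h3 (by omega)) (Or.inr hm3)
      exact ((Ki_le_pow hb hex hm hi hB).2 ho).trans (Nat.pow_le_pow_right (by omega) hG.1)

theorem Ki_add_le_Ki_succ {b : ℕ} (hb : 2 ≤ b) (hex : AllAttained b) {m : ℕ} (hm : 1 ≤ m)
    (H : ∀ l, 3 ≤ l → l ≤ m + 1 → Grows b l) {i : ZMod (b - 1)} (hi : i ∈ I b) :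
    Ki b i m < Ki b i (m + 1) ∧
      (Even b ∨ 2 ≤ m → Ki b i m + 2 * (b - 1) ≤ Ki b i (m + 1)) := by
  have hlow := pow_B_le_Ki hb hex (show 2 ≤ m + 1 by omega) hi
  by_cases h : Even b ∨ 2 ≤ m
  · suffices Ki b i m + 2 * (b - 1) ≤ Ki b i (m + 1) from ⟨by omega, fun _ => this⟩
    have hB := two_le_B_of_grows hb hex (show 2 ≤ m + 1 by omega) H
      (h.imp_right fun h => by omega)
    have hsq : b ^ 2 ≤ b ^ B b (m + 1) := Nat.pow_le_pow_right (by omega) hB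
    have hb4 : 4 * (b - 1) ≤ b ^ 2 := by
      obtain ⟨a, rfl⟩ : ∃ a, b = a + 2 := ⟨b - 2, by omega⟩
      rw [show a + 2 - 1 = a + 1 by omega]
      nlinarith
    rcases eq_or_lt_of_le hm with rfl | hm2
    · have := (Ki_one_le hb hi).1
      omega
    · have := two_mul_Ki_le hb hex hm2 H hi
      omega
  · refine ⟨?_, fun h' => absurd h' h⟩
    push Not at h
    obtain rfl : m = 1 := by omega
    have h1 := (Ki_one_le hb hi).2 (Nat.not_even_iff_odd.1 h.1)
    have h2 : b ^ 1 ≤ b ^ B b (1 + 1) :=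
      Nat.pow_le_pow_right (by omega) (one_le_B hb hex le_rfl)
    rw [pow_one] at h2
    omega

theorem neg_sub_two_neg_sub_two {b : ℕ} (i : ZMod (b - 1)) : -(-i - 2) - 2 = i := by ring

theorem K'_le {b : ℕ} (hb : 2 ≤ b) (hex : AllAttained b) {n j l : ℕ} (hj : 1 ≤ j) (hl : 1 ≤ l)
    (hn : j + l = n) (H : ∀ l, 3 ≤ l → l < n → Grows b l) {i : ZMod (b - 1)} (hi : i ∈ I b) :
    K' b i n ≤ Ki b i j + Ki b (-i - 2) l := by
  have hi' := neg_sub_two_mem_I hb hi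
  have key : ∀ p, n / 2 + 1 ≤ p → (n + 1) / 2 + 1 ≤ p → p < n → ∀ t ∈ I b,
      K' b i n ≤ Ki b t p := by
    intro p h1 h2 h3 t ht
    have hq2 : 2 ≤ n / 2 := by omega
    have hlow := pow_B_le_Ki hb hex (show 2 ≤ p by omega) ht
    have bound : ∀ m, 2 ≤ m → m + 1 ≤ p → ∀ t ∈ I b, 2 * Ki b t m ≤ b ^ B b p := by
      intro m hm hmp t ht
      refine (two_mul_Ki_le hb hex hm (fun l h3 hl => H l h3 (by omega)) ht).trans ?_
      exact Nat.pow_le_pow_right (by omega)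
        (B_mono_of_grows (by omega) hmp fun l h3 hl => H l h3 (by omega))
    have b1 := bound (n / 2) hq2 h1 _ hi'
    have b2 := bound ((n + 1) / 2) (by omega) h2 _ hi
    exact (min_le_left _ _).trans (by omega)
  rcases lt_or_ge ((n + 1) / 2) j with h | h
  · exact (key j (by omega) h (by omega) i hi).trans (Nat.le_add_right _ _)
  rcases lt_or_ge ((n + 1) / 2) l with h' | h'
  · exact (key l (by omega) h' (by omega) _ hi').trans (Nat.le_add_left _ _)
  · rcases (show (j = (n + 1) / 2 ∧ l = n / 2) ∨ (j = n / 2 ∧ l = (n + 1) / 2) by omega) with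
      ⟨rfl, rfl⟩ | ⟨rfl, rfl⟩
    · exact min_le_left _ _
    · exact min_le_right _ _

theorem sub_one_mul_B_le_K' {b : ℕ} (hb : 2 ≤ b) (hex : AllAttained b) {n : ℕ} (hn : 2 ≤ n)
    {i : ZMod (b - 1)} (hi : i ∈ I b) : (b - 1) * B b n ≤ K' b i n + 2 := by
  have h1 := sub_one_mul_B_le hb hex (show 1 ≤ (n + 1) / 2 by omega)
    (show 1 ≤ n / 2 by omega) (show _ = n by omega) hi
  have h2 := sub_one_mul_B_le hb hex (show 1 ≤ n / 2 by omega)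
    (show 1 ≤ (n + 1) / 2 by omega) (show _ = n by omega) hi
  unfold K'
  omega

theorem exists_K'_eq {b : ℕ} (hb : 2 ≤ b) (hex : AllAttained b) {n : ℕ} (hn : 2 ≤ n)
    (H : ∀ l, 3 ≤ l → l < n → Grows b l) :
    ∃ i ∈ I b, K' b i n + 2 = (b - 1) * B b n := by
  obtain ⟨i, hi, j, l, hj, hl, hjl, h⟩ := exists_Ki_add_eq_B hb hex hn
  have h1 := K'_le hb hex hj hl hjl H hi
  have h2 := sub_one_mul_B_le_K' hb hex hn hi
  exact ⟨i, hi, by omega⟩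

theorem grows {b : ℕ} (hb : 2 ≤ b) (hex : AllAttained b) (n : ℕ) (hn : 3 ≤ n) : Grows b n := by
  induction n using Nat.strong_induction_on with
  | _ n ih =>
  have H : ∀ l, 3 ≤ l → l < n → Grows b l := fun l h3 hl => ih l hl h3
  obtain ⟨i, hi, h⟩ : ∃ i ∈ I b,
      Ki b i ((n + 1) / 2) + Ki b (-i - 2) (n / 2) + 2 = (b - 1) * B b n := by
    obtain ⟨i, hi, h⟩ := exists_K'_eq hb hex (by omega) H
    rcases min_choice (Ki b i ((n + 1) / 2) + Ki b (-i - 2) (n / 2))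
      (Ki b i (n / 2) + Ki b (-i - 2) ((n + 1) / 2)) with h' | h'
    · exact ⟨i, hi, by rw [← h, K', h']⟩
    · refine ⟨-i - 2, neg_sub_two_mem_I hb hi, ?_⟩
      rw [← h, K', h', neg_sub_two_neg_sub_two]
      ring
  obtain ⟨p, hp⟩ : ∃ p, (n + 1) / 2 = p + 1 := ⟨(n + 1) / 2 - 1, by omega⟩
  rw [hp] at h
  have hprev := sub_one_mul_B_le hb hex (show 1 ≤ p by omega) (show 1 ≤ n / 2 by omega)
    (show p + n / 2 = n - 1 by omega) hi
  obtain ⟨h1, h2⟩ := Ki_add_le_Ki_succ hb hex (show 1 ≤ p by omega)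
    (fun l h3 hl => H l h3 (by omega)) hi
  refine ⟨Nat.lt_of_mul_lt_mul_left (a := b - 1) (by omega), fun hc => ?_⟩
  have h3 := h2 (hc.imp_right fun h => by omega)
  refine Nat.le_of_mul_le_mul_left (c := b - 1) ?_ (by omega)
  rw [mul_add, mul_comm (b - 1) 2]
  omega

theorem stmt17 (b : ℕ) (hb : 2 ≤ b)
    (hex : ∀ m, 1 ≤ m → ∀ i ∈ I b, ∃ u : ℕ, F b u = m ∧ (u : ZMod (b - 1)) = i) :
    (∀ n, 2 ≤ n →
      (∀ i ∈ I b,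
        IsLeast {x : ℕ | ∃ j, 1 ≤ j ∧ j ≤ n - 1 ∧ x = Ki b i j + Ki b (-i - 2) (n - j)}
          (K' b i n)) ∧
      (b - 1) * B b n = sInf {x : ℕ | ∃ i ∈ I b, x = K' b i n} + 2) ∧
    (∀ n, 3 ≤ n →
      (Odd b ∧ (n = 3 ∨ n = 4) → B b (n - 1) + 1 ≤ B b n) ∧
      (¬(Odd b ∧ (n = 3 ∨ n = 4)) → B b (n - 1) + 2 ≤ B b n)) := by
  have H : ∀ l, 3 ≤ l → Grows b l := grows hb hex
  refine ⟨fun n hn => ⟨fun i hi => ⟨?_, ?_⟩, ?_⟩, fun n hn => ⟨fun _ => (H n hn).1, fun h => ?_⟩⟩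
  · rcases min_choice (Ki b i ((n + 1) / 2) + Ki b (-i - 2) (n / 2))
      (Ki b i (n / 2) + Ki b (-i - 2) ((n + 1) / 2)) with h | h
    · exact ⟨(n + 1) / 2, by omega, by omega,
        by rw [K', h, show n - (n + 1) / 2 = n / 2 by omega]⟩
    · exact ⟨n / 2, by omega, by omega,
        by rw [K', h, show n - n / 2 = (n + 1) / 2 by omega]⟩
  · rintro _ ⟨j, hj, hjn, rfl⟩
    exact K'_le hb hex hj (by omega) (by omega) (fun l h3 _ => H l h3) hi
  · obtain ⟨i, hi, h⟩ := exists_K'_eq hb hex hn fun l h3 _ => H l h3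
    have hleast : IsLeast {x : ℕ | ∃ i ∈ I b, x = K' b i n} (K' b i n) := by
      refine ⟨⟨i, hi, rfl⟩, ?_⟩
      rintro _ ⟨t, ht, rfl⟩
      have := sub_one_mul_B_le_K' hb hex hn ht
      omega
    rw [hleast.csInf_eq, h]
  · refine (H n hn).2 ?_
    rcases Nat.even_or_odd b with he | ho
    · exact Or.inl he
    · right
      by_contra h5
      exact h ⟨ho, by omega⟩

end Kaprekar
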